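/- Suppose a group G of invertible linear maps of ℝ^n preserves a central hyperplane arrangement, acts transitively on the chambers, the face weights w are G-invariant, and there is b ∈ (0,1] such that for every hyperplane index i, the total weight of faces F with F_i ≠ 0 equals b. Then for every t ∈ ℕ the separation distance of the chamber walk satisfies s(t) ≤ m·(1−b)^t, where m is the number of hyperplanes. In particular s(t) ≤ e^{−c} whenever t ≥ log_{1/(1−b)} m + c/b for c > 0. -/

import Mathlib

open Finset

/-- The sign vector of a point `p` with respect to the linear functionals `f i`
defining the hyperplanes `H i = ker (f i)`. -/
noncomputable def signVec {n m : ℕ} (f : Fin m → ((Fin n → ℝ) →ₗ[ℝ] ℝ))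
    (p : Fin n → ℝ) : Fin m → SignType :=
  fun i => SignType.sign (f i p)

/-- A face is a sign vector realized by some point. -/
def IsFace {n m : ℕ} (f : Fin m → ((Fin n → ℝ) →ₗ[ℝ] ℝ)) (F : Fin m → SignType) : Prop :=
  ∃ p : Fin n → ℝ, signVec f p = F

/-- A chamber is a realized sign vector all of whose coordinates are nonzero. -/
def IsChamber {n m : ℕ} (f : Fin m → ((Fin n → ℝ) →ₗ[ℝ] ℝ)) (C : Fin m → SignType) : Prop :=
  IsFace f C ∧ ∀ i, C i ≠ 0

/-- The face product on sign vectors. -/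
def signProd {m : ℕ} (F G : Fin m → SignType) : Fin m → SignType :=
  fun i => if F i ≠ 0 then F i else G i

/-- The partial product `F^k ∘ ⋯ ∘ F^1` of the first `k` chosen faces
(`ω s` is the face chosen at step `s+1`). -/
def faceProdUpTo {m t : ℕ} (ω : Fin t → (Fin m → SignType)) : ℕ → (Fin m → SignType)
  | 0 => fun _ => 0
  | k + 1 => if h : k < t then signProd (ω ⟨k, h⟩) (faceProdUpTo ω k) else faceProdUpTo ω k

/-- The chamber reached after `t` steps of the walk started at `x0`. -/
def chamberAt {m t : ℕ} (x0 : Fin m → SignType) (ω : Fin t → (Fin m → SignType)) :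
    Fin m → SignType :=
  signProd (faceProdUpTo ω t) x0

/-- Probability of an event depending on the first `t` i.i.d. faces drawn from `w`. -/
noncomputable def faceProb {m : ℕ} (w : (Fin m → SignType) → ℝ) (t : ℕ)
    (E : Set (Fin t → (Fin m → SignType))) : ℝ :=
  ∑ ω : Fin t → (Fin m → SignType), Set.indicator E (fun ω => ∏ s, w (ω s)) ω


open Filter Topology in
lemma isFace_signProd {n m : ℕ} (f : Fin m → ((Fin n → ℝ) →ₗ[ℝ] ℝ)) {F G : Fin m → SignType}
    (hF : IsFace f F) (hG : IsFace f G) : IsFace f (signProd F G) := by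
  obtain ⟨p, rfl⟩ := hF
  obtain ⟨q, rfl⟩ := hG
  have key : ∀ i, ∀ᶠ ε : ℝ in 𝓝[>] 0,
      signVec f (p + ε • q) i = signProd (signVec f p) (signVec f q) i := by
    intro i
    have hc : Tendsto (fun ε : ℝ => f i p + ε * f i q) (𝓝[>] 0) (𝓝 (f i p)) := by
      have : Continuous (fun ε : ℝ => f i p + ε * f i q) := by fun_prop
      have h2 := this.tendsto 0
      simp only [zero_mul, add_zero] at h2
      exact h2.mono_left nhdsWithin_le_nhds
    rcases lt_trichotomy (f i p) 0 with h | h | h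
    · filter_upwards [hc.eventually (gt_mem_nhds h)] with ε hε
      simp [signVec, signProd, sign_neg h, sign_neg hε]
    · filter_upwards [self_mem_nhdsWithin] with ε hε
      have hε : 0 < ε := hε
      simp [signVec, signProd, h, sign_mul, sign_pos hε]
    · filter_upwards [hc.eventually (lt_mem_nhds h)] with ε hε
      simp [signVec, signProd, sign_pos h, sign_pos hε]
  obtain ⟨ε, hε⟩ := (eventually_all.2 key).exists
  exact ⟨p + ε • q, funext hε⟩

lemma isFace_faceProdUpTo {n m t : ℕ} (f : Fin m → ((Fin n → ℝ) →ₗ[ℝ] ℝ))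
    (ω : Fin t → (Fin m → SignType)) (h : ∀ s, IsFace f (ω s)) (k : ℕ) :
    IsFace f (faceProdUpTo ω k) := by
  induction k with
  | zero => exact ⟨0, by ext i; simp [signVec, faceProdUpTo]⟩
  | succ k ih =>
    rw [faceProdUpTo]
    split_ifs with hk
    · exact isFace_signProd f (h _) ih
    · exact ih

lemma faceProdUpTo_eq_zero {m t : ℕ} (ω : Fin t → (Fin m → SignType)) (i : Fin m) (k : ℕ)
    (h : faceProdUpTo ω k i = 0) : ∀ s : Fin t, s.1 < k → ω s i = 0 := by
  induction k with
  | zero => intro s hs; omega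
  | succ k ih =>
    intro s hs
    rw [faceProdUpTo] at h
    split_ifs at h with hk
    · simp only [signProd] at h
      have h0 : ω ⟨k, hk⟩ i = 0 := by
        by_contra hne
        rw [if_pos hne] at h
        exact hne h
      rw [if_neg (not_not.2 h0)] at h
      rcases Nat.lt_succ_iff_lt_or_eq.1 hs with h1 | h1
      · exact ih h s h1
      · have : s = ⟨k, hk⟩ := Fin.ext h1
        rw [this]; exact h0
    · exact ih h s (by omega)

/-- The action on sign vectors. -/
def signAct {m : ℕ} (ρ : Fin m → Fin m) (s : Fin m → SignType) (F : Fin m → SignType) :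
    Fin m → SignType := fun j => s j * F (ρ j)

lemma signAct_signProd {m : ℕ} (ρ : Fin m → Fin m) (s : Fin m → SignType) (hs : ∀ j, s j ≠ 0)
    (F G : Fin m → SignType) :
    signAct ρ s (signProd F G) = signProd (signAct ρ s F) (signAct ρ s G) := by
  ext j
  simp only [signAct, signProd]
  by_cases h : F (ρ j) = 0 <;> simp [h, hs j]

lemma signAct_faceProdUpTo {m t : ℕ} (ρ : Fin m → Fin m) (s : Fin m → SignType)
    (hs : ∀ j, s j ≠ 0) (ω : Fin t → (Fin m → SignType)) (k : ℕ) :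
    faceProdUpTo (fun r => signAct ρ s (ω r)) k = signAct ρ s (faceProdUpTo ω k) := by
  induction k with
  | zero => ext j; simp [faceProdUpTo, signAct]
  | succ k ih =>
    rw [faceProdUpTo, faceProdUpTo]
    split_ifs with hk
    · rw [ih, signAct_signProd _ _ hs]
    · exact ih

lemma signAct_injective {m : ℕ} (ρ : Fin m → Fin m) (hρ : Function.Injective ρ)
    (s : Fin m → SignType) (hs : ∀ j, s j ≠ 0) : Function.Injective (signAct ρ s) := by
  intro F G h
  have hsur := Finite.surjective_of_injective hρ
  ext i
  obtain ⟨j, rfl⟩ := hsur i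
  have h2 := congrFun h j
  simp only [signAct] at h2
  have h3 := hs j
  revert h2 h3
  generalize s j = a
  generalize F (ρ j) = x
  generalize G (ρ j) = y
  revert a x y
  decide

lemma exists_smul_of_ker {V : Type*} [AddCommGroup V] [Module ℝ V] (a c : V →ₗ[ℝ] ℝ) (ha : a ≠ 0)
    (h : LinearMap.ker c = LinearMap.ker a) : ∃ r : ℝ, r ≠ 0 ∧ ∀ p, a p = r * c p := by
  obtain ⟨v, hv⟩ : ∃ v, a v ≠ 0 := by
    by_contra! h0
    exact ha (LinearMap.ext h0)
  have hcv : c v ≠ 0 := by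
    intro h0
    have : v ∈ LinearMap.ker c := h0
    rw [h] at this
    exact hv this
  refine ⟨a v / c v, div_ne_zero hv hcv, fun p => ?_⟩
  have : p - (c p / c v) • v ∈ LinearMap.ker c := by
    simp [hcv]
  rw [h] at this
  simp only [LinearMap.mem_ker, map_sub, map_smul, smul_eq_mul] at this
  have h5 : a p = c p / c v * a v := by linarith
  rw [h5]; ring

/-- An element permuting the hyperplanes acts on sign vectors. -/
lemma exists_signAct {n m : ℕ}
    (f : Fin m → ((Fin n → ℝ) →ₗ[ℝ] ℝ))
    (hf0 : ∀ i, f i ≠ 0)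
    (hfdist : ∀ i j, i ≠ j → LinearMap.ker (f i) ≠ LinearMap.ker (f j))
    (g : (Fin n → ℝ) ≃ₗ[ℝ] (Fin n → ℝ))
    (hg : ∀ i : Fin m, ∃ j : Fin m,
      Submodule.map ((g⁻¹ : (Fin n → ℝ) ≃ₗ[ℝ] (Fin n → ℝ)) : (Fin n → ℝ) →ₗ[ℝ] (Fin n → ℝ))
        (LinearMap.ker (f i)) = LinearMap.ker (f j)) :
    ∃ (ρ : Fin m → Fin m) (s : Fin m → SignType), Function.Injective ρ ∧ (∀ j, s j ≠ 0) ∧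
      ∀ p, signVec f (g p) = signAct ρ s (signVec f p) := by
  choose ρ hρ using hg
  have hinj : Function.Injective ρ := by
    intro j j' h
    by_contra hne
    apply hfdist j j' hne
    have h2 := (hρ j).trans ((congrArg (fun k => LinearMap.ker (f k)) h).trans (hρ j').symm)
    exact Submodule.map_injective_of_injective (g⁻¹ : (Fin n → ℝ) ≃ₗ[ℝ] (Fin n → ℝ)).injective h2
  have hr : ∀ j, ∃ r : ℝ, r ≠ 0 ∧ ∀ p, f j (g p) = r * f (ρ j) p := by
    intro j
    have h1 : LinearMap.ker (f (ρ j)) = LinearMap.ker ((f j).comp (g : (Fin n → ℝ) →ₗ[ℝ] (Fin n → ℝ))) := by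
      rw [← hρ j]
      ext p
      simp only [Submodule.mem_map, LinearMap.mem_ker, LinearMap.comp_apply]
      constructor
      · rintro ⟨y, hy, rfl⟩
        have : g ((g⁻¹ : (Fin n → ℝ) ≃ₗ[ℝ] (Fin n → ℝ)) y) = y := g.apply_symm_apply y
        simpa [this] using hy
      · intro hp
        exact ⟨g p, hp, g.symm_apply_apply p⟩
    have h2 : (f j).comp (g : (Fin n → ℝ) →ₗ[ℝ] (Fin n → ℝ)) ≠ 0 := by
      intro h0
      apply hf0 j
      refine LinearMap.ext fun p => ?_
      obtain ⟨q, rfl⟩ := g.surjective p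
      exact LinearMap.congr_fun h0 q
    exact exists_smul_of_ker _ _ h2 h1
  choose r hr0 hr using hr
  refine ⟨ρ, fun j => SignType.sign (r j), hinj, fun j => by simpa using hr0 j, fun p => ?_⟩
  ext j
  simp [signVec, signAct, hr, sign_mul]

lemma faceProb_symm {n m : ℕ}
    (f : Fin m → ((Fin n → ℝ) →ₗ[ℝ] ℝ))
    (hf0 : ∀ i, f i ≠ 0)
    (hfdist : ∀ i j, i ≠ j → LinearMap.ker (f i) ≠ LinearMap.ker (f j))
    (w : (Fin m → SignType) → ℝ)
    (hwface : ∀ F, w F ≠ 0 → IsFace f F)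
    (g : (Fin n → ℝ) ≃ₗ[ℝ] (Fin n → ℝ))
    (hg : ∀ i : Fin m, ∃ j : Fin m,
      Submodule.map ((g⁻¹ : (Fin n → ℝ) ≃ₗ[ℝ] (Fin n → ℝ)) : (Fin n → ℝ) →ₗ[ℝ] (Fin n → ℝ))
        (LinearMap.ker (f i)) = LinearMap.ker (f j))
    (hw : ∀ p, w (signVec f (g p)) = w (signVec f p))
    (p : Fin n → ℝ) (t : ℕ) :
    faceProb w t {ω | faceProdUpTo ω t = signVec f p} =
      faceProb w t {ω | faceProdUpTo ω t = signVec f (g p)} := by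
  obtain ⟨ρ, s, hρ, hs, hact⟩ := exists_signAct f hf0 hfdist g hg
  have hinj := signAct_injective ρ hρ s hs
  have hwa : ∀ F, w (signAct ρ s F) = w F := by
    intro F
    by_cases hF : IsFace f F
    · obtain ⟨q, rfl⟩ := hF
      rw [← hact, hw]
    · have h1 : w F = 0 := by
        by_contra h; exact hF (hwface F h)
      rw [h1]
      by_contra h
      obtain ⟨q, hq⟩ := hwface _ h
      apply hF
      refine ⟨g.symm q, hinj ?_⟩
      rw [← hact, g.apply_symm_apply, hq]
  have hbij : Function.Bijective
      (fun (ω : Fin t → (Fin m → SignType)) => fun r => signAct ρ s (ω r)) := by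
    apply Finite.injective_iff_bijective.1
    intro ω ω' h
    ext1 r
    exact hinj (congrFun h r)
  unfold faceProb
  refine Fintype.sum_bijective _ hbij _ _ ?_
  intro ω
  classical
  simp only [Set.indicator_apply, Set.mem_ofPred_eq, signAct_faceProdUpTo ρ s hs, hact, hwa,
    hinj.eq_iff]

lemma faceProb_mono {m : ℕ} (w : (Fin m → SignType) → ℝ) (hw0 : ∀ F, 0 ≤ w F) (t : ℕ)
    {E E' : Set (Fin t → (Fin m → SignType))} (h : E ⊆ E') : faceProb w t E ≤ faceProb w t E' :=
  Finset.sum_le_sum fun ω _ =>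
    Set.indicator_le_indicator_of_subset h (fun _ => Finset.prod_nonneg fun _ _ => hw0 _) ω

lemma faceProb_zero_le {m : ℕ} (w : (Fin m → SignType) → ℝ) (hw0 : ∀ F, 0 ≤ w F)
    (hw1 : ∑ F, w F = 1) (b : ℝ) (i : Fin m)
    (hbw : ∑ F, (if F i ≠ 0 then w F else 0) = b) (t : ℕ) :
    faceProb w t {ω | faceProdUpTo ω t i = 0} ≤ (1 - b) ^ t := by
  classical
  have h1 : ∑ F : Fin m → SignType, (if F i = 0 then w F else 0) = 1 - b := by
    rw [← hw1, ← hbw, ← Finset.sum_sub_distrib]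
    refine Finset.sum_congr rfl fun F _ => ?_
    by_cases h : F i = 0 <;> simp [h]
  rw [← h1, Fintype.sum_pow]
  refine Finset.sum_le_sum fun ω _ => ?_
  rw [Set.indicator_apply]
  split_ifs with h
  · refine le_of_eq (Finset.prod_congr rfl fun s _ => ?_)
    rw [if_pos (faceProdUpTo_eq_zero ω i t h s s.2)]
  · exact Finset.prod_nonneg fun s _ => by split_ifs <;> simp [hw0]

lemma total_bound {n m : ℕ} (f : Fin m → ((Fin n → ℝ) →ₗ[ℝ] ℝ))
    (w : (Fin m → SignType) → ℝ) (hw0 : ∀ F, 0 ≤ w F) (hw1 : ∑ F, w F = 1)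
    (hwface : ∀ F, w F ≠ 0 → IsFace f F) (t : ℕ)
    [Fintype {C : Fin m → SignType // IsChamber f C}] :
    1 ≤ ∑ x : {C : Fin m → SignType // IsChamber f C},
        faceProb w t {ω | faceProdUpTo ω t = x.1} +
      ∑ i, faceProb w t {ω | faceProdUpTo ω t i = 0} := by
  classical
  have h1 : (1 : ℝ) = ∑ ω : Fin t → (Fin m → SignType), ∏ s, w (ω s) := by
    rw [← Fintype.sum_pow, hw1, one_pow]
  rw [h1]
  unfold faceProb
  rw [Finset.sum_comm, Finset.sum_comm (s := (univ : Finset (Fin m))), ← Finset.sum_add_distrib]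
  refine Finset.sum_le_sum fun ω _ => ?_
  have hW : 0 ≤ ∏ s, w (ω s) := Finset.prod_nonneg fun _ _ => hw0 _
  have hn : ∀ E : Set (Fin t → (Fin m → SignType)),
      0 ≤ Set.indicator E (fun ω => ∏ s, w (ω s)) ω := fun E =>
    Set.indicator_apply_nonneg fun _ => hW
  by_cases hz : ∃ i, faceProdUpTo ω t i = 0
  · obtain ⟨i, hi⟩ := hz
    have h2 := Finset.single_le_sum (f := fun i => Set.indicator {ω | faceProdUpTo ω t i = 0}
      (fun ω : Fin t → (Fin m → SignType) => ∏ s, w (ω s)) ω) (fun i _ => hn _) (Finset.mem_univ i)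
    have h3 := Finset.sum_nonneg (s := univ)
      (f := fun x : {C : Fin m → SignType // IsChamber f C} =>
        Set.indicator {ω | faceProdUpTo ω t = x.1}
      (fun ω : Fin t → (Fin m → SignType) => ∏ s, w (ω s)) ω) (fun i _ => hn _)
    have h4 : ω ∈ {ω : Fin t → (Fin m → SignType) | faceProdUpTo ω t i = 0} := hi
    simp only [Set.indicator_of_mem h4] at h2
    linarith
  · push Not at hz
    have h3 := Finset.sum_nonneg (s := univ) (f := fun i => Set.indicator
      {ω | faceProdUpTo ω t i = 0}
      (fun ω : Fin t → (Fin m → SignType) => ∏ s, w (ω s)) ω) (fun i _ => hn _)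
    have h5 := Finset.sum_nonneg (s := univ)
      (f := fun x : {C : Fin m → SignType // IsChamber f C} =>
        Set.indicator {ω | faceProdUpTo ω t = x.1}
      (fun ω : Fin t → (Fin m → SignType) => ∏ s, w (ω s)) ω) (fun i _ => hn _)
    by_cases h0 : ∏ s, w (ω s) = 0
    · linarith
    · have hF : IsFace f (faceProdUpTo ω t) := isFace_faceProdUpTo f ω
        (fun s => hwface _ (Finset.prod_ne_zero_iff.1 h0 s (Finset.mem_univ s))) t
      have h2 := Finset.single_le_sum (f := fun x : {C : Fin m → SignType // IsChamber f C} =>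
        Set.indicator {ω | faceProdUpTo ω t = x.1}
        (fun ω : Fin t → (Fin m → SignType) => ∏ s, w (ω s)) ω) (fun i _ => hn _)
        (Finset.mem_univ (⟨faceProdUpTo ω t, hF, hz⟩ : {C : Fin m → SignType // IsChamber f C}))
      have h4 : ω ∈ {ω' : Fin t → (Fin m → SignType) | faceProdUpTo ω' t = faceProdUpTo ω t} := rfl
      simp only [Set.indicator_of_mem h4] at h2
      linarith

lemma rate_bound (m : ℕ) (b : ℝ) (hb0 : 0 < b) (hb1 : b ≤ 1) (c : ℝ) (hc : 0 < c) (t : ℕ)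
    (h : Real.logb (1 / (1 - b)) m + c / b ≤ (t : ℝ)) :
    (m : ℝ) * (1 - b) ^ t ≤ Real.exp (-c) := by
  rcases Nat.eq_zero_or_pos m with rfl | hm
  · simpa using (Real.exp_pos _).le
  rcases eq_or_lt_of_le hb1 with rfl | hb
  · have ht : t ≠ 0 := by
      rintro rfl
      simp [Real.logb] at h
      linarith
    simp [ht]
    exact (Real.exp_pos _).le
  have hm' : (0 : ℝ) < m := by exact_mod_cast hm
  have hq : 0 < 1 - b := by linarith
  have hl : Real.log (1 - b) ≤ -b := by
    have := Real.log_le_sub_one_of_pos hq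
    linarith
  have hln : 0 < - Real.log (1 - b) := by linarith
  rw [← Real.exp_log (mul_pos hm' (pow_pos hq t)), Real.exp_le_exp, Real.log_mul hm'.ne'
    (pow_pos hq t).ne', Real.log_pow]
  have e : Real.logb (1 / (1 - b)) m = Real.log m / (-Real.log (1 - b)) := by
    rw [Real.logb, one_div, Real.log_inv]
  rw [e] at h
  have h2 := mul_le_mul_of_nonneg_right h hln.le
  rw [add_mul, div_mul_cancel₀ _ hln.ne'] at h2
  have h3 : c ≤ c / b * (-Real.log (1 - b)) := by
    calc c = c / b * b := by field_simp
      _ ≤ _ := mul_le_mul_of_nonneg_left (by linarith) (by positivity)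
  linarith

/-- Under a chamber-transitive, arrangement-preserving group action with `G`-invariant
weights, if additionally every hyperplane has total face-weight `b ∈ (0,1]` off it,
then the separation distance satisfies `s(t) ≤ m (1-b)^t`; in particular
`s(t) ≤ e^{-c}` whenever `t ≥ log_{1/(1-b)} m + c/b` with `c > 0`. -/
theorem separation_upper_bound {n m : ℕ}
    (f : Fin m → ((Fin n → ℝ) →ₗ[ℝ] ℝ))
    (hf0 : ∀ i, f i ≠ 0)
    (hfdist : ∀ i j, i ≠ j → LinearMap.ker (f i) ≠ LinearMap.ker (f j))
    (w : (Fin m → SignType) → ℝ)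
    (hw0 : ∀ F, 0 ≤ w F) (hw1 : ∑ F, w F = 1)
    (hwface : ∀ F, w F ≠ 0 → IsFace f F)
    (G : Subgroup ((Fin n → ℝ) ≃ₗ[ℝ] (Fin n → ℝ)))
    (hGpres : ∀ g : G, ∀ i : Fin m, ∃ j : Fin m,
      Submodule.map ((g : (Fin n → ℝ) ≃ₗ[ℝ] (Fin n → ℝ)) : (Fin n → ℝ) →ₗ[ℝ] (Fin n → ℝ))
        (LinearMap.ker (f i)) = LinearMap.ker (f j))
    (hGtrans : ∀ C D : Fin m → SignType, IsChamber f C → IsChamber f D →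
      ∃ g : G, ∀ p : Fin n → ℝ, signVec f p = C →
        signVec f ((g : (Fin n → ℝ) ≃ₗ[ℝ] (Fin n → ℝ)) p) = D)
    (hGinv : ∀ g : G, ∀ p : Fin n → ℝ,
      w (signVec f ((g : (Fin n → ℝ) ≃ₗ[ℝ] (Fin n → ℝ)) p)) = w (signVec f p))
    (b : ℝ) (hb0 : 0 < b) (hb1 : b ≤ 1)
    (hbw : ∀ i : Fin m, ∑ F, (if F i ≠ 0 then w F else 0) = b) :
    (∀ t : ℕ,
      (⨆ x0 : {C : Fin m → SignType // IsChamber f C},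
        (1 - ⨅ x : {C : Fin m → SignType // IsChamber f C},
          faceProb w t {ω | chamberAt (x0 : Fin m → SignType) ω = (x : Fin m → SignType)}
            / (1 / (Nat.card {C : Fin m → SignType // IsChamber f C} : ℝ))))
        ≤ m * (1 - b) ^ t) ∧
    (∀ c : ℝ, 0 < c → ∀ t : ℕ, Real.logb (1 / (1 - b)) m + c / b ≤ (t : ℝ) →
      (⨆ x0 : {C : Fin m → SignType // IsChamber f C},
        (1 - ⨅ x : {C : Fin m → SignType // IsChamber f C},
          faceProb w t {ω | chamberAt (x0 : Fin m → SignType) ω = (x : Fin m → SignType)}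
            / (1 / (Nat.card {C : Fin m → SignType // IsChamber f C} : ℝ))))
        ≤ Real.exp (-c)) := by
  have main : ∀ t : ℕ,
      (⨆ x0 : {C : Fin m → SignType // IsChamber f C},
        (1 - ⨅ x : {C : Fin m → SignType // IsChamber f C},
          faceProb w t {ω | chamberAt (x0 : Fin m → SignType) ω = (x : Fin m → SignType)}
            / (1 / (Nat.card {C : Fin m → SignType // IsChamber f C} : ℝ))))
        ≤ m * (1 - b) ^ t := by
    intro t
    classical
    have hRHS : 0 ≤ (m : ℝ) * (1 - b) ^ t :=
      mul_nonneg (Nat.cast_nonneg _) (pow_nonneg (by linarith) _)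
    refine Real.iSup_le (fun x0 => ?_) hRHS
    have : Nonempty {C : Fin m → SignType // IsChamber f C} := ⟨x0⟩
    have : 1 - (m : ℝ) * (1 - b) ^ t ≤ ⨅ x : {C : Fin m → SignType // IsChamber f C},
          faceProb w t {ω | chamberAt (x0 : Fin m → SignType) ω = (x : Fin m → SignType)}
            / (1 / (Nat.card {C : Fin m → SignType // IsChamber f C} : ℝ)) := by
      refine le_ciInf fun x => ?_
      have : Fintype {C : Fin m → SignType // IsChamber f C} := Fintype.ofFinite _
      have hsub : faceProb w t {ω | faceProdUpTo ω t = x.1} ≤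
          faceProb w t {ω | chamberAt (x0 : Fin m → SignType) ω = (x : Fin m → SignType)} := by
        apply faceProb_mono w hw0
        intro ω hω
        have hω : faceProdUpTo ω t = x.1 := hω
        ext1 i
        simp only [chamberAt, signProd, hω]
        rw [if_pos (x.2.2 i)]
      have hsymm : ∀ y : {C : Fin m → SignType // IsChamber f C},
          faceProb w t {ω | faceProdUpTo ω t = y.1} =
          faceProb w t {ω | faceProdUpTo ω t = x.1} := by
        intro y
        obtain ⟨g, hg⟩ := hGtrans y.1 x.1 y.2 x.2
        obtain ⟨p, hp⟩ := y.2.1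
        rw [← hg p hp, ← hp]
        exact faceProb_symm f hf0 hfdist w hwface g.1 (fun i => hGpres g⁻¹ i) (hGinv g) p t
      have htot := total_bound f w hw0 hw1 hwface t
      rw [Finset.sum_congr rfl (fun y _ => hsymm y)] at htot
      have hz : ∑ i, faceProb w t {ω | faceProdUpTo ω t i = 0} ≤ m * (1 - b) ^ t := by
        refine (Finset.sum_le_sum fun i _ => faceProb_zero_le w hw0 hw1 b i (hbw i) t).trans ?_
        simp
      rw [div_div_eq_mul_div, div_one, Nat.card_eq_fintype_card]
      rw [Finset.sum_const, nsmul_eq_mul, Finset.card_univ] at htot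
      have := mul_le_mul_of_nonneg_right hsub
        (Nat.cast_nonneg (α := ℝ) (Fintype.card {C : Fin m → SignType // IsChamber f C}))
      linarith
    linarith
  exact ⟨main, fun c hc t ht => (main t).trans (rate_bound m b hb0 hb1 c hc t ht)⟩
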